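/- arXiv:2210.12874 — 6 statements merged into one kernel-verified Lean document; each statement's English description precedes it below -/
import Mathlib

section
/- Upper bound on the global NT-Xent loss (Lemma 3.3): L^Global_X ≤ (1/N) · ∑_{i} τ⁻¹·( −⟨x i, y i⟩ + max_{j ∈ Fin N} ⟨x i, y j⟩ ) + log N. -/
open scoped RealInnerProductSpace

/-- Lemma 3.3: upper bound on the global NT-Xent loss. -/
theorem global_ntxent_upper_bound
    (N d : ℕ) (hN : 0 < N) (hd : 0 < d) (τ : ℝ) (hτ : 0 < τ)
    (x y : Fin N → EuclideanSpace ℝ (Fin d))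
    (hx : ∀ i, ‖x i‖ = 1) (hy : ∀ i, ‖y i‖ = 1) :
    (1 / N : ℝ) * ∑ i : Fin N, (-⟪x i, y i⟫ / τ +
        Real.log (∑ j : Fin N, Real.exp (⟪x i, y j⟫ / τ))) ≤
      (1 / N : ℝ) * (∑ i : Fin N, τ⁻¹ *
        (-⟪x i, y i⟫ +
          Finset.univ.sup' ⟨⟨0, hN⟩, Finset.mem_univ _⟩ (fun j => ⟪x i, y j⟫)))
        + Real.log N := by
  have hN' : (0 : ℝ) < N := by exact_mod_cast hN
  have key : ∀ i : Fin N, -⟪x i, y i⟫ / τ +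
        Real.log (∑ j : Fin N, Real.exp (⟪x i, y j⟫ / τ)) ≤
      τ⁻¹ * (-⟪x i, y i⟫ +
          Finset.univ.sup' ⟨⟨0, hN⟩, Finset.mem_univ _⟩ (fun j => ⟪x i, y j⟫))
        + Real.log N := by
    intro i
    set M := Finset.univ.sup' ⟨⟨0, hN⟩, Finset.mem_univ _⟩ (fun j => ⟪x i, y j⟫) with hM
    have hle : ∀ j, ⟪x i, y j⟫ ≤ M := fun j =>
      Finset.le_sup' (fun j => ⟪x i, y j⟫) (Finset.mem_univ j)
    have hsum : ∑ j : Fin N, Real.exp (⟪x i, y j⟫ / τ) ≤ N * Real.exp (M / τ) := by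
      calc ∑ j : Fin N, Real.exp (⟪x i, y j⟫ / τ)
          ≤ ∑ _j : Fin N, Real.exp (M / τ) := by
            apply Finset.sum_le_sum
            intro j _
            exact Real.exp_le_exp.mpr (div_le_div_of_nonneg_right (hle j) hτ.le)
        _ = N * Real.exp (M / τ) := by simp
    have hpos : 0 < ∑ j : Fin N, Real.exp (⟪x i, y j⟫ / τ) :=
      Finset.sum_pos (fun j _ => Real.exp_pos _) ⟨⟨0, hN⟩, Finset.mem_univ _⟩
    have hlog := Real.log_le_log hpos hsum
    rw [Real.log_mul hN'.ne' (Real.exp_pos _).ne', Real.log_exp] at hlog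
    have e : τ⁻¹ * (-⟪x i, y i⟫ + M) = -⟪x i, y i⟫ / τ + M / τ := by ring
    rw [e]
    linarith
  have h := Finset.sum_le_sum (fun i (_ : i ∈ Finset.univ) => key i)
  have h2 := mul_le_mul_of_nonneg_left h (by positivity : (0 : ℝ) ≤ 1 / N)
  refine h2.trans (le_of_eq ?_)
  rw [Finset.sum_add_distrib, mul_add]
  congr 1
  simp only [Finset.sum_const, Finset.card_univ, Fintype.card_fin, nsmul_eq_mul]
  field_simp
end

section
/- First upper bound on the global-minus-training loss gap (Theorem 3.6): L^Global_X − L^Train_X ≤ (1/N) · ∑_{i} τ⁻¹·( max_{j ∈ Fin N} ⟨x i, y j⟩ − min_{j ∈ B i} ⟨x i, y j⟩ ) + log(N/k). -/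
open scoped RealInnerProductSpace

/-- Theorem 3.6: first upper bound on the gap between the global and the
training NT-Xent losses. -/
theorem ntxent_gap_upper_bound_min
    (N k d : ℕ) (hN : 0 < N) (hk : 0 < k) (hd : 0 < d) (τ : ℝ) (hτ : 0 < τ)
    (x y : Fin N → EuclideanSpace ℝ (Fin d))
    (hx : ∀ i, ‖x i‖ = 1) (hy : ∀ i, ‖y i‖ = 1)
    (B : Fin N → Finset (Fin N))
    (hBmem : ∀ i, i ∈ B i) (hBcard : ∀ i, (B i).card = k) :
    ((1 / N : ℝ) * ∑ i : Fin N, (-⟪x i, y i⟫ / τ +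
        Real.log (∑ j : Fin N, Real.exp (⟪x i, y j⟫ / τ)))) -
      ((1 / N : ℝ) * ∑ i : Fin N, (-⟪x i, y i⟫ / τ +
        Real.log (∑ j ∈ B i, Real.exp (⟪x i, y j⟫ / τ)))) ≤
      (1 / N : ℝ) * (∑ i : Fin N, τ⁻¹ *
        (Finset.univ.sup' ⟨⟨0, hN⟩, Finset.mem_univ _⟩ (fun j => ⟪x i, y j⟫) -
          (B i).inf' ⟨i, hBmem i⟩ (fun j => ⟪x i, y j⟫)))
        + Real.log ((N : ℝ) / k) := by
  have hN' : (0:ℝ) < N := by exact_mod_cast hN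
  have hk' : (0:ℝ) < k := by exact_mod_cast hk
  have key : ∀ i : Fin N, (-⟪x i, y i⟫ / τ +
        Real.log (∑ j : Fin N, Real.exp (⟪x i, y j⟫ / τ))) ≤ (-⟪x i, y i⟫ / τ +
        Real.log (∑ j ∈ B i, Real.exp (⟪x i, y j⟫ / τ))) + (τ⁻¹ *
        (Finset.univ.sup' ⟨⟨0, hN⟩, Finset.mem_univ _⟩ (fun j => ⟪x i, y j⟫) -
          (B i).inf' ⟨i, hBmem i⟩ (fun j => ⟪x i, y j⟫)) + Real.log ((N : ℝ) / k)) := by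
    intro i
    set M := Finset.univ.sup' ⟨⟨0, hN⟩, Finset.mem_univ _⟩ (fun j => ⟪x i, y j⟫) with hM
    set m := (B i).inf' ⟨i, hBmem i⟩ (fun j => ⟪x i, y j⟫) with hm
    have h1 : ∑ j : Fin N, Real.exp (⟪x i, y j⟫ / τ) ≤ N * Real.exp (M / τ) := by
      have := Finset.sum_le_card_nsmul Finset.univ (fun j => Real.exp (⟪x i, y j⟫ / τ))
        (Real.exp (M / τ)) (fun j hj => by
          have : ⟪x i, y j⟫ ≤ M := Finset.le_sup' (fun j => ⟪x i, y j⟫) hj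
          gcongr)
      simpa using this
    have h2 : k * Real.exp (m / τ) ≤ ∑ j ∈ B i, Real.exp (⟪x i, y j⟫ / τ) := by
      have := Finset.card_nsmul_le_sum (B i) (fun j => Real.exp (⟪x i, y j⟫ / τ))
        (Real.exp (m / τ)) (fun j hj => by
          have : m ≤ ⟪x i, y j⟫ := Finset.inf'_le (fun j => ⟪x i, y j⟫) hj
          gcongr)
      simpa [hBcard i] using this
    have h3 := Real.log_le_log (Finset.sum_pos (fun j _ => Real.exp_pos _)
      ⟨⟨0, hN⟩, Finset.mem_univ _⟩) h1
    have h4 := Real.log_le_log (by positivity) h2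
    rw [Real.log_mul hN'.ne' (Real.exp_ne_zero _), Real.log_exp] at h3
    rw [Real.log_mul hk'.ne' (Real.exp_ne_zero _), Real.log_exp] at h4
    rw [Real.log_div hN'.ne' hk'.ne']
    have h5 : τ⁻¹ * (M - m) = M / τ - m / τ := by ring
    linarith
  have hs := Finset.sum_le_sum (fun i (_ : i ∈ Finset.univ) => key i)
  have h6 : (1 / N : ℝ) * ∑ _i : Fin N, Real.log ((N : ℝ) / k) = Real.log ((N : ℝ) / k) := by
    rw [Finset.sum_const, Finset.card_univ, Fintype.card_fin, nsmul_eq_mul]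
    field_simp
  have hs2 := mul_le_mul_of_nonneg_left hs (by positivity : (0:ℝ) ≤ 1 / N)
  simp only [Finset.sum_add_distrib, mul_add] at hs2 ⊢
  rw [h6] at hs2
  linarith
end

section
/- Second upper bound on the global-minus-training loss gap (Theorem 3.7): L^Global_X − L^Train_X ≤ (1/N) · ∑_{i} τ⁻¹·( max_{j ∈ Fin N} ⟨x i, y j⟩ − max_{j ∈ B i} ⟨x i, y j⟩ ) + log N. -/
open scoped RealInnerProductSpace

theorem lse_upper_aux {ι : Type*} (s : Finset ι) (hs : s.Nonempty) (f : ι → ℝ) (τ : ℝ)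
    (hτ : 0 < τ) :
    Real.log (∑ j ∈ s, Real.exp (f j / τ)) ≤ τ⁻¹ * s.sup' hs f + Real.log (s.card : ℝ) := by
  have hc : (0 : ℝ) < s.card := by exact_mod_cast hs.card_pos
  have h : ∑ j ∈ s, Real.exp (f j / τ) ≤ s.card * Real.exp (τ⁻¹ * s.sup' hs f) := by
    rw [← nsmul_eq_mul]
    refine Finset.sum_le_card_nsmul _ _ _ fun j hj => ?_
    rw [Real.exp_le_exp, div_eq_inv_mul]
    exact mul_le_mul_of_nonneg_left (Finset.le_sup' f hj) (inv_nonneg.2 hτ.le)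
  have hp : 0 < ∑ j ∈ s, Real.exp (f j / τ) := Finset.sum_pos (fun _ _ => Real.exp_pos _) hs
  have h2 := Real.log_le_log hp h
  rw [Real.log_mul hc.ne' (Real.exp_pos _).ne', Real.log_exp] at h2
  linarith

theorem lse_lower_aux {ι : Type*} (s : Finset ι) (hs : s.Nonempty) (f : ι → ℝ) (τ : ℝ) :
    τ⁻¹ * s.sup' hs f ≤ Real.log (∑ j ∈ s, Real.exp (f j / τ)) := by
  obtain ⟨j, hj, he⟩ := Finset.exists_mem_eq_sup' hs f
  rw [he, ← div_eq_inv_mul,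
    Real.le_log_iff_exp_le (Finset.sum_pos (fun _ _ => Real.exp_pos _) hs)]
  exact Finset.single_le_sum (f := fun j => Real.exp (f j / τ))
    (fun _ _ => (Real.exp_pos _).le) hj

/-- Theorem 3.7: second upper bound on the gap between the global and the
training NT-Xent losses. -/
theorem ntxent_gap_upper_bound_max
    (N k d : ℕ) (hN : 0 < N) (hk : 0 < k) (hd : 0 < d) (τ : ℝ) (hτ : 0 < τ)
    (x y : Fin N → EuclideanSpace ℝ (Fin d))
    (hx : ∀ i, ‖x i‖ = 1) (hy : ∀ i, ‖y i‖ = 1)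
    (B : Fin N → Finset (Fin N))
    (hBmem : ∀ i, i ∈ B i) (hBcard : ∀ i, (B i).card = k) :
    ((1 / N : ℝ) * ∑ i : Fin N, (-⟪x i, y i⟫ / τ +
        Real.log (∑ j : Fin N, Real.exp (⟪x i, y j⟫ / τ)))) -
      ((1 / N : ℝ) * ∑ i : Fin N, (-⟪x i, y i⟫ / τ +
        Real.log (∑ j ∈ B i, Real.exp (⟪x i, y j⟫ / τ)))) ≤
      (1 / N : ℝ) * (∑ i : Fin N, τ⁻¹ *
        (Finset.univ.sup' ⟨⟨0, hN⟩, Finset.mem_univ _⟩ (fun j => ⟪x i, y j⟫) -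
          (B i).sup' ⟨i, hBmem i⟩ (fun j => ⟪x i, y j⟫)))
        + Real.log N := by
  have hN' : (0 : ℝ) < N := by exact_mod_cast hN
  have hlog : Real.log N = (1 / N : ℝ) * ∑ _i : Fin N, Real.log N := by
    simp [hN'.ne']
  rw [hlog, ← mul_sub, ← mul_add, ← Finset.sum_sub_distrib, ← Finset.sum_add_distrib]
  refine mul_le_mul_of_nonneg_left (Finset.sum_le_sum fun i _ => ?_) (by positivity)
  have h1 := lse_upper_aux Finset.univ ⟨⟨0, hN⟩, Finset.mem_univ _⟩ (fun j => ⟪x i, y j⟫) τ hτ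
  have h2 := lse_lower_aux (B i) ⟨i, hBmem i⟩ (fun j => ⟪x i, y j⟫) τ
  rw [Finset.card_univ, Fintype.card_fin] at h1
  rw [mul_sub]
  linarith
end

section
/- Symmetrized min-based gap bound (Appendix A.1): (L^Global_X − L^Train_X) + (L^Global_Y − L^Train_Y) ≤ (1/N) · ∑_{i} τ⁻¹·( max_{j ∈ Fin N} ⟨x i, y j⟩ − min_{j ∈ B i} ⟨x i, y j⟩ + max_{j ∈ Fin N} ⟨y i, x j⟩ − min_{j ∈ B i} ⟨y i, x j⟩ ) + 2·log(N/k). -/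
open scoped RealInnerProductSpace

theorem gap_aux (N k : ℕ) (hN : 0 < N) (hk : 0 < k) (τ : ℝ) (hτ : 0 < τ)
    (f : Fin N → ℝ) (S : Finset (Fin N)) (hS : S.Nonempty) (hU : (Finset.univ : Finset (Fin N)).Nonempty)
    (hc : S.card = k) :
    Real.log (∑ j : Fin N, Real.exp (f j / τ)) - Real.log (∑ j ∈ S, Real.exp (f j / τ)) ≤
      τ⁻¹ * (Finset.univ.sup' hU f - S.inf' hS f) + Real.log ((N : ℝ) / k) := by
  have hN' : (0 : ℝ) < N := by exact_mod_cast hN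
  have hk' : (0 : ℝ) < k := by exact_mod_cast hk
  have h1 : Real.log (∑ j : Fin N, Real.exp (f j / τ)) ≤
      Real.log N + Finset.univ.sup' hU f / τ := by
    rw [← Real.log_exp (Finset.univ.sup' hU f / τ), ← Real.log_mul hN'.ne' (Real.exp_pos _).ne']
    apply Real.log_le_log (Finset.sum_pos (fun _ _ => Real.exp_pos _) hU)
    have := Finset.sum_le_card_nsmul (Finset.univ : Finset (Fin N)) (fun j => Real.exp (f j / τ))
      (Real.exp (Finset.univ.sup' hU f / τ)) (fun j hj => Real.exp_le_exp.2
        (div_le_div_of_nonneg_right (Finset.le_sup' f hj) hτ.le))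
    simpa using this
  have h2 : Real.log k + S.inf' hS f / τ ≤ Real.log (∑ j ∈ S, Real.exp (f j / τ)) := by
    rw [← Real.log_exp (S.inf' hS f / τ), ← Real.log_mul hk'.ne' (Real.exp_pos _).ne']
    apply Real.log_le_log (by positivity)
    have := Finset.card_nsmul_le_sum S (fun j => Real.exp (f j / τ))
      (Real.exp (S.inf' hS f / τ)) (fun j hj => Real.exp_le_exp.2
        (div_le_div_of_nonneg_right (Finset.inf'_le f hj) hτ.le))
    simpa [hc] using this
  rw [Real.log_div hN'.ne' hk'.ne']
  have h3 : τ⁻¹ * (Finset.univ.sup' hU f - S.inf' hS f) =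
    Finset.univ.sup' hU f / τ - S.inf' hS f / τ := by ring
  linarith

/-- Appendix A.1: symmetrized min-based bound on the sum of the gaps between
the global and training NT-Xent losses over `X` and over `Y`. -/
theorem ntxent_symmetrized_gap_upper_bound_min
    (N k d : ℕ) (hN : 0 < N) (hk : 0 < k) (hd : 0 < d) (τ : ℝ) (hτ : 0 < τ)
    (x y : Fin N → EuclideanSpace ℝ (Fin d))
    (hx : ∀ i, ‖x i‖ = 1) (hy : ∀ i, ‖y i‖ = 1)
    (B : Fin N → Finset (Fin N))
    (hBmem : ∀ i, i ∈ B i) (hBcard : ∀ i, (B i).card = k) :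
    (((1 / N : ℝ) * ∑ i : Fin N, (-⟪x i, y i⟫ / τ +
        Real.log (∑ j : Fin N, Real.exp (⟪x i, y j⟫ / τ)))) -
      ((1 / N : ℝ) * ∑ i : Fin N, (-⟪x i, y i⟫ / τ +
        Real.log (∑ j ∈ B i, Real.exp (⟪x i, y j⟫ / τ))))) +
    (((1 / N : ℝ) * ∑ i : Fin N, (-⟪y i, x i⟫ / τ +
        Real.log (∑ j : Fin N, Real.exp (⟪y i, x j⟫ / τ)))) -
      ((1 / N : ℝ) * ∑ i : Fin N, (-⟪y i, x i⟫ / τ +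
        Real.log (∑ j ∈ B i, Real.exp (⟪y i, x j⟫ / τ))))) ≤
      (1 / N : ℝ) * (∑ i : Fin N, τ⁻¹ *
        (Finset.univ.sup' ⟨⟨0, hN⟩, Finset.mem_univ _⟩ (fun j => ⟪x i, y j⟫) -
          (B i).inf' ⟨i, hBmem i⟩ (fun j => ⟪x i, y j⟫) +
         Finset.univ.sup' ⟨⟨0, hN⟩, Finset.mem_univ _⟩ (fun j => ⟪y i, x j⟫) -
          (B i).inf' ⟨i, hBmem i⟩ (fun j => ⟪y i, x j⟫)))
        + 2 * Real.log ((N : ℝ) / k) := by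
  have hN' : (0 : ℝ) < N := by exact_mod_cast hN
  have hL : 2 * Real.log ((N : ℝ) / k) =
      (1 / N : ℝ) * ∑ i : Fin N, 2 * Real.log ((N : ℝ) / k) := by
    simp only [Finset.sum_const, Finset.card_univ, Fintype.card_fin, nsmul_eq_mul]
    field_simp
  rw [hL, ← mul_sub, ← mul_sub, ← mul_add, ← mul_add, ← Finset.sum_sub_distrib,
    ← Finset.sum_sub_distrib, ← Finset.sum_add_distrib, ← Finset.sum_add_distrib]
  apply mul_le_mul_of_nonneg_left _ (by positivity)
  apply Finset.sum_le_sum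
  intro i _
  have a := gap_aux N k hN hk τ hτ (fun j => ⟪x i, y j⟫) (B i) ⟨i, hBmem i⟩
    ⟨⟨0, hN⟩, Finset.mem_univ _⟩ (hBcard i)
  have b := gap_aux N k hN hk τ hτ (fun j => ⟪y i, x j⟫) (B i) ⟨i, hBmem i⟩
    ⟨⟨0, hN⟩, Finset.mem_univ _⟩ (hBcard i)
  linarith
end

section
/- Symmetrized max-based gap bound (Appendix A.2): (L^Global_X − L^Train_X) + (L^Global_Y − L^Train_Y) ≤ (1/N) · ∑_{i} τ⁻¹·( max_{j ∈ Fin N} ⟨x i, y j⟩ − max_{j ∈ B i} ⟨x i, y j⟩ + max_{j ∈ Fin N} ⟨y i, x j⟩ − max_{j ∈ B i} ⟨y i, x j⟩ ) + 2·log N. -/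
open scoped RealInnerProductSpace

theorem ntx_aux (N : ℕ) (hN : 0 < N) (τ : ℝ) (hτ : 0 < τ) (f : Fin N → ℝ)
    (B : Finset (Fin N)) (hU : (Finset.univ : Finset (Fin N)).Nonempty) (hB : B.Nonempty) :
    Real.log (∑ j : Fin N, Real.exp (f j / τ)) - Real.log (∑ j ∈ B, Real.exp (f j / τ)) ≤
      τ⁻¹ * (Finset.univ.sup' hU f - B.sup' hB f) + Real.log N := by
  have hNr : (0 : ℝ) < N := by exact_mod_cast hN
  have h1 : Real.log (∑ j : Fin N, Real.exp (f j / τ)) ≤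
      Real.log N + Finset.univ.sup' hU f / τ := by
    rw [← Real.log_exp (Finset.univ.sup' hU f / τ), ← Real.log_mul hNr.ne' (Real.exp_pos _).ne']
    apply Real.log_le_log (Finset.sum_pos (fun _ _ => Real.exp_pos _) hU)
    have := Finset.sum_le_card_nsmul (Finset.univ : Finset (Fin N))
      (fun j => Real.exp (f j / τ)) (Real.exp (Finset.univ.sup' hU f / τ)) (by
        intro j hj
        have := Finset.le_sup' f hj
        apply Real.exp_le_exp.mpr
        exact div_le_div_of_nonneg_right this hτ.le)
    simpa using this
  have h2 : B.sup' hB f / τ ≤ Real.log (∑ j ∈ B, Real.exp (f j / τ)) := by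
    obtain ⟨j, hj, e⟩ := Finset.exists_mem_eq_sup' hB f
    rw [e, ← Real.log_exp (f j / τ)]
    apply Real.log_le_log (Real.exp_pos _)
    exact Finset.single_le_sum (f := fun j => Real.exp (f j / τ))
      (fun _ _ => (Real.exp_pos _).le) hj
  rw [mul_sub, inv_mul_eq_div, inv_mul_eq_div]
  linarith

/-- Appendix A.2: symmetrized max-based bound on the sum of the gaps between
the global and training NT-Xent losses over `X` and over `Y`. -/
theorem ntxent_symmetrized_gap_upper_bound_max
    (N k d : ℕ) (hN : 0 < N) (hk : 0 < k) (hd : 0 < d) (τ : ℝ) (hτ : 0 < τ)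
    (x y : Fin N → EuclideanSpace ℝ (Fin d))
    (hx : ∀ i, ‖x i‖ = 1) (hy : ∀ i, ‖y i‖ = 1)
    (B : Fin N → Finset (Fin N))
    (hBmem : ∀ i, i ∈ B i) (hBcard : ∀ i, (B i).card = k) :
    (((1 / N : ℝ) * ∑ i : Fin N, (-⟪x i, y i⟫ / τ +
        Real.log (∑ j : Fin N, Real.exp (⟪x i, y j⟫ / τ)))) -
      ((1 / N : ℝ) * ∑ i : Fin N, (-⟪x i, y i⟫ / τ +
        Real.log (∑ j ∈ B i, Real.exp (⟪x i, y j⟫ / τ))))) +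
    (((1 / N : ℝ) * ∑ i : Fin N, (-⟪y i, x i⟫ / τ +
        Real.log (∑ j : Fin N, Real.exp (⟪y i, x j⟫ / τ)))) -
      ((1 / N : ℝ) * ∑ i : Fin N, (-⟪y i, x i⟫ / τ +
        Real.log (∑ j ∈ B i, Real.exp (⟪y i, x j⟫ / τ))))) ≤
      (1 / N : ℝ) * (∑ i : Fin N, τ⁻¹ *
        (Finset.univ.sup' ⟨⟨0, hN⟩, Finset.mem_univ _⟩ (fun j => ⟪x i, y j⟫) -
          (B i).sup' ⟨i, hBmem i⟩ (fun j => ⟪x i, y j⟫) +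
         Finset.univ.sup' ⟨⟨0, hN⟩, Finset.mem_univ _⟩ (fun j => ⟪y i, x j⟫) -
          (B i).sup' ⟨i, hBmem i⟩ (fun j => ⟪y i, x j⟫)))
        + 2 * Real.log N := by
  have hNr : (0 : ℝ) < N := by exact_mod_cast hN
  have e : 2 * Real.log N = (1 / N : ℝ) * ∑ i : Fin N, 2 * Real.log N := by
    simp
    field_simp
  rw [e, ← mul_sub, ← mul_sub, ← mul_add, ← mul_add, ← Finset.sum_sub_distrib,
    ← Finset.sum_sub_distrib, ← Finset.sum_add_distrib, ← Finset.sum_add_distrib]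
  apply mul_le_mul_of_nonneg_left _ (by positivity)
  apply Finset.sum_le_sum
  intro i _
  have a := ntx_aux N hN τ hτ (fun j => ⟪x i, y j⟫) (B i) ⟨⟨0, hN⟩, Finset.mem_univ _⟩ ⟨i, hBmem i⟩
  have b := ntx_aux N hN τ hτ (fun j => ⟪y i, x j⟫) (B i) ⟨⟨0, hN⟩, Finset.mem_univ _⟩ ⟨i, hBmem i⟩
  simp only [mul_sub, mul_add] at a b ⊢
  linarith
end

section
/- Combined QAP lower bound (Theorem 4.2, honest form): let σ be a permutation of Fin N and B i := { j ∈ Fin N : ⌊(σ i : ℕ)/k⌋ = ⌊(σ j : ℕ)/k⌋ } the sequential batches, A the block-diagonal 0/1 matrix with A p q = 1 iff ⌊(p : ℕ)/k⌋ = ⌊(q : ℕ)/k⌋, P the permutation matrix of σ, and M the matrix M i j = ⟨x i, y j⟩ + ⟨y i, x j⟩. Then ∑_{i ∈ Fin N} ( max_{j ∈ B i} ⟨x i, y j⟩ + max_{j ∈ B i} ⟨y i, x j⟩ ) ≥ (1/k) · trace(A * P * M * Pᵀ); i.e., the batch-dependent term of the symmetrized max-based gap bound is lower bounded by 1/k times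 the QAP objective Tr(A π (XYᵀ + YXᵀ) πᵀ). -/
open scoped RealInnerProductSpace
open Matrix

/-- Theorem 4.2 (honest form): the batch-dependent term of the symmetrized
max-based gap bound is lower bounded by `1/k` times the QAP objective
`Tr(A π (XYᵀ + YXᵀ) πᵀ)` under sequential batching. -/
theorem qap_combined_lower_bound
    (N k d : ℕ) (hN : 0 < N) (hk : 0 < k) (hkN : k ∣ N) (hd : 0 < d)
    (x y : Fin N → EuclideanSpace ℝ (Fin d))
    (hx : ∀ i, ‖x i‖ = 1) (hy : ∀ i, ‖y i‖ = 1)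
    (σ : Equiv.Perm (Fin N))
    (A P M : Matrix (Fin N) (Fin N) ℝ)
    (hA : ∀ p q, A p q = if (p : ℕ) / k = (q : ℕ) / k then 1 else 0)
    (hP : ∀ p q, P p q = if p = σ q then 1 else 0)
    (hM : ∀ i j, M i j = ⟪x i, y j⟫ + ⟪y i, x j⟫) :
    ∑ i : Fin N,
      ((Finset.univ.filter (fun j => (σ i : ℕ) / k = (σ j : ℕ) / k)).sup'
          ⟨i, by simp⟩ (fun j => ⟪x i, y j⟫) +
        (Finset.univ.filter (fun j => (σ i : ℕ) / k = (σ j : ℕ) / k)).sup'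
          ⟨i, by simp⟩ (fun j => ⟪y i, x j⟫)) ≥
      (1 / k : ℝ) * Matrix.trace (A * P * M * Pᵀ) := by
  classical
  have hk' : (0:ℝ) < k := by exact_mod_cast hk
  have hAP : ∀ p q, (A * P) p q = A p (σ q) := by
    intro p q
    simp [Matrix.mul_apply, hP]
  have htr : Matrix.trace (A * P * M * Pᵀ) = ∑ i, ∑ j, A (σ i) (σ j) * M i j := by
    have h1 : ∀ p, (A * P * M * Pᵀ) p p = ∑ q, if p = σ q then (A * P * M) p q else 0 := by
      intro p
      rw [Matrix.mul_apply]
      simp [Matrix.transpose_apply, hP]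
    simp only [Matrix.trace, Matrix.diag_apply, h1]
    rw [Finset.sum_comm]
    refine Finset.sum_congr rfl fun i _ => ?_
    rw [Finset.sum_ite_eq' Finset.univ (σ i) (fun p => (A * P * M) p i)]
    simp only [Finset.mem_univ, if_true]
    rw [Matrix.mul_apply]
    refine Finset.sum_congr rfl fun j _ => ?_
    rw [hAP, hM j i, hM i j, real_inner_comm (x j) (y i), real_inner_comm (y j) (x i)]
    ring
  have hcard : ∀ i : Fin N,
      (Finset.univ.filter (fun j => (σ i : ℕ) / k = (σ j : ℕ) / k)).card = k := by
    intro i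
    obtain ⟨m, rfl⟩ := hkN
    have hlt : (σ i : ℕ) / k < m := Nat.div_lt_of_lt_mul (σ i).2
    have : (Finset.univ.filter (fun j => (σ i : ℕ) / k = (σ j : ℕ) / k)).card
        = (Finset.Ico (k * ((σ i : ℕ) / k)) (k * ((σ i : ℕ) / k) + k)).card := by
      refine Finset.card_bij (fun j _ => (σ j : ℕ)) ?_ ?_ ?_
      · intro j hj
        have hj' := (Finset.mem_filter.mp hj).2
        rw [hj', Finset.mem_Ico]
        have h1 := Nat.div_add_mod (σ j : ℕ) k
        have h2 := Nat.mod_lt (σ j : ℕ) hk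
        omega
      · intro a _ b _ h
        exact σ.injective (Fin.ext h)
      · intro b hb
        rw [Finset.mem_Ico] at hb
        have hb2 : b < k * m := by
          have : k * ((σ i : ℕ) / k + 1) ≤ k * m := Nat.mul_le_mul_left k hlt
          rw [Nat.mul_add] at this
          omega
        refine ⟨σ.symm ⟨b, hb2⟩, ?_, by simp⟩
        simp only [Finset.mem_filter, Finset.mem_univ, true_and, Equiv.apply_symm_apply]
        symm
        rw [Nat.div_eq_iff hk]
        have := Nat.mul_comm k ((σ i : ℕ) / k)
        constructor <;> omega
    rw [this]
    simp
  have key : ∀ (i : Fin N) (f : Fin N → ℝ) (h : _),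
      ∑ j ∈ Finset.univ.filter (fun j => (σ i : ℕ) / k = (σ j : ℕ) / k), f j ≤ k *
      (Finset.univ.filter (fun j => (σ i : ℕ) / k = (σ j : ℕ) / k)).sup' h f := by
    intro i f h
    have := Finset.sum_le_card_nsmul
      (Finset.univ.filter (fun j => (σ i : ℕ) / k = (σ j : ℕ) / k)) f
      ((Finset.univ.filter (fun j => (σ i : ℕ) / k = (σ j : ℕ) / k)).sup' h f) (fun j hj => Finset.le_sup' f hj)
    rw [hcard i, nsmul_eq_mul] at this
    exact this
  rw [ge_iff_le, one_div, inv_mul_le_iff₀ hk', htr, Finset.mul_sum]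
  refine Finset.sum_le_sum fun i _ => ?_
  have e : ∑ j, A (σ i) (σ j) * M i j =
      ∑ j ∈ Finset.univ.filter (fun j => (σ i : ℕ) / k = (σ j : ℕ) / k),
        (⟪x i, y j⟫ + ⟪y i, x j⟫) := by
    rw [Finset.sum_filter]
    refine Finset.sum_congr rfl fun j _ => ?_
    rw [hA, hM]
    split_ifs <;> simp
  rw [e, Finset.sum_add_distrib, mul_add]
  exact add_le_add (key i _ _) (key i _ _)
end
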